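/- Suppose G is bipartite and let w ∈ ℝ^n satisfy ‖w‖₀ ≤ ⌊(n−1)/2⌋. Then w is the unique minimizer of the ℓ₁-norm ‖w̄‖₁ over all w̄ ∈ ℝ^n satisfying R w̄ = R w; that is, every w̄ ≠ w with R w̄ = R w satisfies ‖w̄‖₁ > ‖w‖₁. -/

import Mathlib

open Matrix

/-- The signless edge–node incidence matrix of a simple graph `G`. -/
noncomputable def signlessInc (n : ℕ) (G : SimpleGraph (Fin n)) :
    Matrix G.edgeSet (Fin n) ℝ :=
  Matrix.of fun e i => if i ∈ (e : Sym2 (Fin n)) then (1 : ℝ) else 0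

/-- `G` is bipartite. -/
def IsBipartite {n : ℕ} (G : SimpleGraph (Fin n)) : Prop :=
  ∃ Vp Vm : Set (Fin n), Disjoint Vp Vm ∧ Vp ∪ Vm = Set.univ ∧
    ∀ ⦃u v : Fin n⦄, G.Adj u v → (u ∈ Vp ∧ v ∈ Vm) ∨ (u ∈ Vm ∧ v ∈ Vp)

/-- The number of nonzero entries of a vector (its `ℓ₀`-"norm"). -/
noncomputable def zeroNorm {n : ℕ} (w : Fin n → ℝ) : ℕ := Set.ncard {i | w i ≠ 0}

/-- The row of the signless incidence matrix at an edge `uv` maps `w` to `w u + w v`. -/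
lemma signlessInc_mulVec_apply {n : ℕ} {G : SimpleGraph (Fin n)} {u v : Fin n}
    (h : G.Adj u v) (w : Fin n → ℝ) :
    (signlessInc n G *ᵥ w) ⟨s(u, v), h⟩ = w u + w v := by
  have hterm : ∀ i : Fin n, (if i = u ∨ i = v then w i else 0)
      = (if i = u then w i else 0) + (if i = v then w i else 0) := by
    intro i
    have := h.ne
    by_cases hu : i = u
    · subst hu
      simp [this]
    · simp [hu]
  simp [signlessInc, Matrix.mulVec, dotProduct, hterm, Finset.sum_add_distrib]

/-- If `w` and `x` have the same image under the signless incidence matrix of a connected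
graph, then the entries of `x - w` all have the same absolute value. -/
lemma abs_sub_eq_of_signlessInc_mulVec_eq {n : ℕ} {G : SimpleGraph (Fin n)}
    (hG : G.Connected) {w x : Fin n → ℝ}
    (h : signlessInc n G *ᵥ x = signlessInc n G *ᵥ w) (a b : Fin n) :
    |x a - w a| = |x b - w b| := by
  obtain ⟨p⟩ := hG.preconnected a b
  induction p with
  | nil => rfl
  | @cons u v _ huv _ ih =>
    have he := congrFun h ⟨s(u, v), huv⟩
    rw [signlessInc_mulVec_apply huv, signlessInc_mulVec_apply huv] at he
    rw [← ih, show x u - w u = -(x v - w v) by linarith, abs_neg]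

/-- for bipartite `G` and `‖w‖₀ ≤ ⌊(n-1)/2⌋`, the vector `w` is the unique
`ℓ₁`-norm minimizer over `{w̄ : R w̄ = R w}`: any other feasible `w̄` has strictly larger
`ℓ₁`-norm. -/
theorem stmt18 {n : ℕ} (hn : 2 ≤ n) (G : SimpleGraph (Fin n)) (hconn : G.Connected)
    (hbip : IsBipartite G) (w : Fin n → ℝ) (hwsp : zeroNorm w ≤ (n - 1) / 2) :
    ∀ wbar : Fin n → ℝ, wbar ≠ w →
      signlessInc n G *ᵥ wbar = signlessInc n G *ᵥ w →
      ∑ i : Fin n, |w i| < ∑ i : Fin n, |wbar i| := by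
  classical
  intro x hne h
  obtain ⟨a, ha⟩ := Function.ne_iff.mp hne
  have hc : 0 < |x a - w a| := abs_pos.mpr (sub_ne_zero.mpr ha)
  have hd : ∀ i, |x i - w i| = |x a - w a| := fun i =>
    abs_sub_eq_of_signlessInc_mulVec_eq hconn h i a
  set c := |x a - w a|
  set S : Finset (Fin n) := Finset.univ.filter fun i => w i ≠ 0 with hS
  have hcard : zeroNorm w = S.card := by
    rw [zeroNorm, ← Set.ncard_coe_finset, hS]
    simp
  have hlt : (2 * S.card : ℝ) < n := by
    have : 2 * S.card < n := by omega
    exact_mod_cast this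
  have hpt : ∀ i, |w i| + (c - 2 * if w i ≠ 0 then c else 0) ≤ |x i| := by
    intro i
    rw [← hd i]
    split_ifs with hi
    · have := abs_sub_abs_le_abs_sub (w i) (x i)
      rw [abs_sub_comm] at this
      linarith
    · rw [not_not.mp hi]
      simp
  have hsum : ∑ i, (|w i| + (c - 2 * if w i ≠ 0 then c else 0))
      = ∑ i, |w i| + c * (n - 2 * S.card) := by
    rw [Finset.sum_add_distrib, Finset.sum_sub_distrib, ← Finset.mul_sum,
      ← Finset.sum_filter, ← hS]
    simp
    ring
  have hle := Finset.sum_le_sum fun i (_ : i ∈ Finset.univ) => hpt i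
  rw [hsum] at hle
  have : 0 < c * (n - 2 * S.card) := mul_pos hc (by linarith)
  linarith
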